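/- There is a constant c > 0 such that for every orderon W and every ε ∈ (0,1) there exist a positive integer n ≤ (c/ε⁴)·2^{162/ε²} and a symmetric function G : [n]² → [0,1] (a weighted ordered graph on n vertices) such that d△(W, W_G) ≤ ε, where W_G is the naive n-block orderon of G. -/

import Mathlib

open MeasureTheory Real Filter
open scoped ENNReal Classical

noncomputable section

/-- The unit interval `[0,1]` as a subtype of `ℝ`. -/
abbrev UI : Type := Set.Icc (0:ℝ) 1

/-- The unit square `[0,1]²`. -/
abbrev USq : Type := UI × UI

/-- An orderon: a symmetric measurable function `([0,1]²)² → [0,1]`. -/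
def IsOrderon (W : USq → USq → ℝ) : Prop :=
  Measurable (Function.uncurry W) ∧ (∀ u v, W u v ∈ Set.Icc (0:ℝ) 1) ∧
    ∀ u v, W u v = W v u

/-- The (unordered) cut norm: `sup_{S,T} |∫_{S×T} W|` over measurable `S,T ⊆ [0,1]²`. -/
def cutNorm (W : USq → USq → ℝ) : ℝ :=
  sSup {x | ∃ S T : Set USq, MeasurableSet S ∧ MeasurableSet T ∧
    x = |∫ p in S ×ˢ T, W p.1 p.2|}

/-- A measure-preserving bijection of `[0,1]²` with measure-preserving inverse. -/
def IsMPB (f : USq → USq) : Prop :=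
  MeasurePreserving f volume volume ∧
  ∃ g : USq → USq, MeasurePreserving g volume volume ∧
    Function.LeftInverse g f ∧ Function.RightInverse g f

/-- `Shift(f) = sup_{(x,a)} |x - π₁(f(x,a))|`. -/
def shiftOf (f : USq → USq) : ℝ := ⨆ u : USq, |(u.1 : ℝ) - ((f u).1 : ℝ)|

/-- The cut-shift distance `d△(W,U) = inf_f (Shift(f) + ‖W - U^f‖_□)`. -/
def csDist (W U : USq → USq → ℝ) : ℝ :=
  sInf {x | ∃ f : USq → USq, IsMPB f ∧
    x = shiftOf f + cutNorm (fun u v => W u v - U (f u) (f v))}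

/-- `Q_n(z) = ⌈nz⌉` for `z ∈ (0,1]`, and `Q_n(0) = 1`. -/
def Qn (n : ℕ) (x : ℝ) : ℕ := max 1 ⌈(n : ℝ) * x⌉₊

/-- The naive `n`-block orderon of a weighted ordered graph `G : [n]² → [0,1]`
(given as a function `ℕ → ℕ → ℝ`, 1-indexed). -/
def blockOrderon (n : ℕ) (G : ℕ → ℕ → ℝ) : USq → USq → ℝ :=
  fun u v => G (Qn n (u.1 : ℝ)) (Qn n (v.1 : ℝ))

open Set ProbabilityTheory

/-- The cumulative distribution function with values in the unit interval. -/
def cdfUI (μ : Measure ℝ) (x : ℝ) : UI := ⟨cdf μ x, cdf_nonneg μ x, cdf_le_one μ x⟩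

lemma measurable_cdfUI (μ : Measure ℝ) : Measurable (cdfUI μ) :=
  (monotone_cdf μ).measurable.subtype_mk

lemma continuous_cdf (μ : Measure ℝ) [IsProbabilityMeasure μ] [NullSingletonClass μ] :
    Continuous (cdf μ) := by
  rw [continuous_iff_continuousAt]
  intro x
  rw [(monotone_cdf μ).continuousAt_iff_leftLim_eq_rightLim, (cdf μ).rightLim_eq]
  refine le_antisymm ((monotone_cdf μ).leftLim_le le_rfl) ?_
  have h : (cdf μ).measure {x} = 0 := by rw [measure_cdf]; exact measure_singleton x
  rw [StieltjesFunction.measure_singleton, ENNReal.ofReal_eq_zero] at h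
  linarith

lemma exists_cdf_eq (μ : Measure ℝ) [IsProbabilityMeasure μ] [NullSingletonClass μ]
    {t : ℝ} (h0 : 0 < t) (h1 : t < 1) : ∃ x, cdf μ x = t := by
  obtain ⟨a, ha⟩ := ((tendsto_cdf_atBot μ).eventually_lt_const h0).exists
  obtain ⟨b, hb⟩ := ((tendsto_cdf_atTop μ).eventually_const_lt h1).exists
  exact mem_range_of_exists_le_of_exists_ge (continuous_cdf μ) ⟨a, ha.le⟩ ⟨b, hb.le⟩

/-- The probability integral transform. -/
lemma measurePreserving_cdfUI (μ : Measure ℝ) [IsProbabilityMeasure μ] [NullSingletonClass μ] :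
    MeasurePreserving (cdfUI μ) μ volume := by
  refine ⟨measurable_cdfUI μ, ?_⟩
  have := Measure.isProbabilityMeasure_map (μ := μ) (measurable_cdfUI μ).aemeasurable
  have hlower : ∀ t : ℝ, 0 ≤ t → t ≤ 1 → ENNReal.ofReal t ≤ μ {x | cdf μ x ≤ t} := by
    intro t h0 h1
    rcases h0.eq_or_lt with rfl | h0
    · simp
    rcases h1.eq_or_lt with rfl | h1
    · simp [cdf_le_one]
    obtain ⟨x, hx⟩ := exists_cdf_eq μ h0 h1
    rw [← hx, ofReal_cdf]
    exact measure_mono fun y hy => monotone_cdf μ hy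
  have hupper : ∀ t : ℝ, 0 < t → t < 1 → μ {x | cdf μ x < t} ≤ ENNReal.ofReal t := by
    intro t h0 h1
    obtain ⟨x, hx⟩ := exists_cdf_eq μ h0 h1
    rw [← hx, ofReal_cdf]
    exact measure_mono fun y hy => ((monotone_cdf μ).reflect_lt hy).le
  refine Measure.ext_of_Iic _ _ fun t => ?_
  rw [Measure.map_apply (measurable_cdfUI μ) measurableSet_Iic, unitInterval.volume_Iic]
  have hset : cdfUI μ ⁻¹' Iic t = {x | cdf μ x ≤ (t : ℝ)} := rfl
  rw [hset]
  refine le_antisymm ?_ (hlower _ t.2.1 t.2.2)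
  rcases t.2.2.eq_or_lt with h1 | h1
  · rw [h1]; simpa using prob_le_one
  refine ge_of_tendsto (x := nhdsWithin (t : ℝ) (Ioi (t : ℝ))) (f := ENNReal.ofReal)
    ((ENNReal.continuous_ofReal.tendsto _).mono_left nhdsWithin_le_nhds) ?_
  filter_upwards [Ioo_mem_nhdsGT h1] with s hs
  exact (measure_mono fun x hx => lt_of_le_of_lt hx hs.1).trans
    (hupper s (t.2.1.trans_lt hs.1) hs.2)

lemma exists_uncountable_null_set (ν : Measure UI) [SFinite ν] :
    ∃ C : Set UI, MeasurableSet C ∧ ¬ C.Countable ∧ ν C = 0 := by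
  have hUI : ¬ Countable UI := by
    rw [Set.countable_coe_iff, ← Cardinal.le_aleph0_iff_set_countable,
      Cardinal.mk_Icc_real zero_lt_one]
    exact not_le.mpr Cardinal.aleph0_lt_continuum
  have hR : ¬ Countable ℝ := not_countable_iff.mpr inferInstance
  have hR2 : ¬ Countable (ℝ × ℝ) := fun h =>
    hR (Function.Injective.countable (f := fun x : ℝ => (x, (0 : ℝ))) fun x y h => by simpa using h)
  let ψ : UI ≃ᵐ ℝ × ℝ := PolishSpace.measurableEquivOfNotCountable hUI hR2
  let A : ℝ → Set UI := fun r => ψ ⁻¹' ({r} ×ˢ univ)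
  have hA : ∀ r, MeasurableSet (A r) := fun r =>
    ψ.measurable ((measurableSet_singleton r).prod MeasurableSet.univ)
  have hc := Measure.countable_meas_pos_of_disjoint_iUnion (μ := ν) hA (by
    intro r s hrs
    refine Set.disjoint_left.mpr fun x hx hy => hrs ?_
    have h1 : (ψ x).1 = r := hx.1
    have h2 : (ψ x).1 = s := hy.1
    exact h1.symm.trans h2)
  obtain ⟨r, hr⟩ : ∃ r, ν (A r) = 0 := by
    by_contra! h
    refine hR (Set.countable_univ_iff.mp (hc.mono fun r _ => pos_iff_ne_zero.mpr (h r)))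
  refine ⟨A r, hA r, fun hcount => hR ?_, hr⟩
  have : Countable (A r) := hcount
  refine Function.Injective.countable
    (f := fun s : ℝ => (⟨ψ.symm (r, s), by simp [A]⟩ : A r)) fun s t hst => ?_
  simpa using hst

lemma exists_equiv_real_unitInterval (μ : Measure ℝ) [IsProbabilityMeasure μ]
    [NullSingletonClass μ] : ∃ e : ℝ ≃ᵐ UI, MeasurePreserving e μ volume := by
  set T := cdfUI μ with hT
  have hTm : Measurable T := measurable_cdfUI μ
  have hmp : MeasurePreserving T μ volume := measurePreserving_cdfUI μ
  obtain ⟨C, hC, hCunc, hC0⟩ := exists_uncountable_null_set volume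
  let D : Set UI := C ∪ range fun q : ℚ => T q
  have hDm : MeasurableSet D := hC.union (countable_range _).measurableSet
  have hD0 : (volume : Measure UI) D = 0 :=
    measure_union_null hC0 ((countable_range _).measure_zero _)
  let B : Set ℝ := T ⁻¹' Dᶜ
  have hBm : MeasurableSet B := hTm hDm.compl
  have hinj : InjOn T B := by
    have key : ∀ x ∈ B, ∀ y, x < y → T x ≠ T y := by
      intro x hx y hxy h
      obtain ⟨q, h1, h2⟩ := exists_rat_btwn hxy
      refine hx (Or.inr ⟨q, le_antisymm ?_ (monotone_cdf μ h1.le)⟩)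
      exact (show T q ≤ T y from monotone_cdf μ h2.le).trans h.ge
    intro x hx y hy h
    rcases lt_trichotomy x y with hxy | hxy | hxy
    · exact absurd h (key x hx y hxy)
    · exact hxy
    · exact absurd h.symm (key y hy x hxy)
  have := hBm.standardBorel
  have hemb : MeasurableEmbedding fun x : B => T x :=
    (hTm.comp measurable_subtype_coe).measurableEmbedding hinj.injective
  let R : Set UI := (fun x : B => T x) '' univ
  have hRm : MeasurableSet R := hemb.measurableSet_image' MeasurableSet.univ
  let e1 : B ≃ᵐ R := (MeasurableEquiv.Set.univ B).symm.trans (hemb.equivImage univ)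
  have hBc : ¬ Countable (Bᶜ : Set ℝ) := by
    intro h
    refine hCunc ?_
    have hsub : C ⊆ T '' Bᶜ ∪ {0, 1} := by
      intro c hc
      by_cases h0 : c = 0
      · simp [h0]
      by_cases h1 : c = 1
      · simp [h1]
      obtain ⟨x, hx⟩ := exists_cdf_eq μ (unitInterval.pos_iff_ne_zero.mpr h0)
        (unitInterval.lt_one_iff_ne_one.mpr h1)
      have hx' : T x = c := Subtype.ext hx
      exact Or.inl ⟨x, fun hxB => hxB (by rw [hx']; exact Or.inl hc), hx'⟩
    exact (((Set.countable_coe_iff.mp h).image T).union (by simp)).mono hsub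
  have hRc : ¬ Countable (Rᶜ : Set UI) := by
    intro h
    refine hCunc ((Set.countable_coe_iff.mp h).mono ?_)
    rintro c hc ⟨x, -, rfl⟩
    exact x.2 (Or.inl hc)
  have := hBm.compl.standardBorel
  have := hRm.compl.standardBorel
  let e2 : (Bᶜ : Set ℝ) ≃ᵐ (Rᶜ : Set UI) := PolishSpace.measurableEquivOfNotCountable hBc hRc
  let e : ℝ ≃ᵐ UI := (MeasurableEquiv.sumCompl hBm).symm.trans
    ((MeasurableEquiv.sumCongr e1 e2).trans (MeasurableEquiv.sumCompl hRm))
  have heB : ∀ x ∈ B, e x = T x := by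
    intro x hx
    have : (MeasurableEquiv.sumCompl hBm).symm x = Sum.inl ⟨x, hx⟩ := by
      rw [MeasurableEquiv.symm_apply_eq]; rfl
    simp only [e, MeasurableEquiv.trans_apply, this]
    rfl
  have hBnull : μ Bᶜ = 0 := by
    have : Bᶜ = T ⁻¹' D := by simp [B]
    rw [this, hmp.measure_preimage hDm.nullMeasurableSet, hD0]
  refine ⟨e, e.measurable, ?_⟩
  rw [← hmp.map_eq]
  refine Measure.map_congr ?_
  rw [Filter.EventuallyEq, ae_iff]
  exact measure_mono_null (fun x hx hxB => hx (heB x hxB)) hBnull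

lemma exists_equiv_unitInterval {X : Type*} [MeasurableSpace X] [StandardBorelSpace X]
    (μ : Measure X) [IsProbabilityMeasure μ] [NullSingletonClass μ] :
    ∃ e : X ≃ᵐ UI, MeasurePreserving e μ volume := by
  have hX : ¬ Countable X := by
    intro h
    have h1 : μ univ = 0 := (Set.countable_univ_iff.mpr h).measure_zero μ
    simp at h1
  let ψ : X ≃ᵐ ℝ :=
    PolishSpace.measurableEquivOfNotCountable hX (not_countable_iff.mpr inferInstance)
  have : IsProbabilityMeasure (μ.map ψ) :=
    Measure.isProbabilityMeasure_map ψ.measurable.aemeasurable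
  have : NullSingletonClass (μ.map ψ) := ⟨fun x => by
    rw [ψ.map_apply]
    have : ψ ⁻¹' {x} = {ψ.symm x} := by ext y; simp [ψ.eq_symm_apply]
    rw [this, measure_singleton]⟩
  obtain ⟨e, he⟩ := exists_equiv_real_unitInterval (μ.map ψ)
  exact ⟨ψ.trans e, he.comp (ψ.measurable.measurePreserving μ)⟩

/-- Two measurable sets of equal positive finite measure in an atomless standard Borel space are
isomorphic. -/
lemma exists_measurePreserving_equiv {X : Type*} [MeasurableSpace X] [StandardBorelSpace X]
    (μ : Measure X) [IsFiniteMeasure μ] [NullSingletonClass μ] {A B : Set X}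
    (hA : MeasurableSet A) (hB : MeasurableSet B) (hAB : μ A = μ B) (h0 : μ A ≠ 0) :
    ∃ e : A ≃ᵐ B, MeasurePreserving e (μ.comap Subtype.val) (μ.comap Subtype.val) := by
  have key : ∀ {A : Set X}, MeasurableSet A → μ A ≠ 0 → ∃ e : A ≃ᵐ UI,
      MeasurePreserving e ((μ A)⁻¹ • μ.comap Subtype.val) volume := by
    intro A hA h0
    have := hA.standardBorel
    have : IsProbabilityMeasure ((μ A)⁻¹ • μ.comap (Subtype.val : A → X)) := ⟨by
      rw [Measure.smul_apply, comap_subtype_coe_apply hA]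
      simp [ENNReal.inv_mul_cancel h0 (measure_ne_top μ A)]⟩
    have : NullSingletonClass ((μ A)⁻¹ • μ.comap (Subtype.val : A → X)) := ⟨fun x => by
      rw [Measure.smul_apply, comap_subtype_coe_apply hA]
      simp⟩
    exact exists_equiv_unitInterval _
  obtain ⟨a, ha⟩ := key hA h0
  obtain ⟨b, hb⟩ := key hB (hAB ▸ h0)
  refine ⟨a.trans b.symm, ?_⟩
  have h := (hb.symm b).comp ha
  have h2 := h.smul_measure (μ A)
  rw [← hAB, smul_smul, smul_smul, ENNReal.mul_inv_cancel h0 (measure_ne_top μ A), one_smul,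
    one_smul] at h2
  exact h2

instance : NullSingletonClass (volume : Measure USq) :=
  inferInstanceAs (NullSingletonClass ((volume : Measure UI).prod volume))

/-- Rearrange a space along two labellings whose fibres have the same measure. -/
lemma exists_isMPB_of_fibers {p q : USq → ℕ} (hp : Measurable p) (hq : Measurable q)
    (hpq : ∀ a, volume (p ⁻¹' {a}) = volume (q ⁻¹' {a}))
    (hp0 : ∀ u, volume (p ⁻¹' {p u}) ≠ 0) (hq0 : ∀ u, volume (q ⁻¹' {q u}) ≠ 0) :
    ∃ f : USq → USq, IsMPB f ∧ ∀ u, q (f u) = p u := by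
  have hpm : ∀ a, MeasurableSet (p ⁻¹' {a}) := fun a => hp (measurableSet_singleton a)
  have hqm : ∀ a, MeasurableSet (q ⁻¹' {a}) := fun a => hq (measurableSet_singleton a)
  have hex : ∀ a, ∃ e : (p ⁻¹' {a}) ≃ᵐ (q ⁻¹' {a}),
      MeasurePreserving e (volume.comap Subtype.val) (volume.comap Subtype.val) := by
    intro a
    by_cases h : volume (p ⁻¹' {a}) = 0
    · have h1 : p ⁻¹' {a} = ∅ := by
        rw [Set.eq_empty_iff_forall_notMem]; rintro u rfl; exact hp0 u h
      have h2 : q ⁻¹' {a} = ∅ := by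
        rw [Set.eq_empty_iff_forall_notMem]; rintro u rfl; exact hq0 u (hpq _ ▸ h)
      rw [h1, h2]
      exact ⟨MeasurableEquiv.refl _, MeasurePreserving.id _⟩
    · exact exists_measurePreserving_equiv volume (hpm a) (hqm a) (hpq a) h
  choose e he using hex
  have glue : ∀ {p q : USq → ℕ}, Measurable p → Measurable q →
      ∀ e : ∀ a, (p ⁻¹' {a}) ≃ᵐ (q ⁻¹' {a}),
      (∀ a, MeasurePreserving (e a) (volume.comap Subtype.val) (volume.comap Subtype.val)) →
      MeasurePreserving (fun u => (e (p u) ⟨u, rfl⟩ : USq)) volume volume := by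
    intro p q hp hq e he
    have hpm : ∀ a, MeasurableSet (p ⁻¹' {a}) := fun a => hp (measurableSet_singleton a)
    have hqm : ∀ a, MeasurableSet (q ⁻¹' {a}) := fun a => hq (measurableSet_singleton a)
    have hpre : ∀ (S : Set USq) (a : ℕ), p ⁻¹' {a} ∩ (fun u => (e (p u) ⟨u, rfl⟩ : USq)) ⁻¹' S =
        Subtype.val '' ((e a) ⁻¹' (Subtype.val ⁻¹' S)) := by
      intro S a
      ext u
      constructor
      · rintro ⟨rfl, h⟩
        exact ⟨⟨u, rfl⟩, h, rfl⟩
      · rintro ⟨⟨u, rfl⟩, h, rfl⟩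
        exact ⟨rfl, h⟩
    have hun : ∀ (r : USq → ℕ) (S : Set USq), S = ⋃ a, r ⁻¹' {a} ∩ S := by
      intro r S; ext u; simp
    have hmeas : Measurable fun u => (e (p u) ⟨u, rfl⟩ : USq) := by
      intro S hS
      rw [hun p (_ ⁻¹' S)]
      refine MeasurableSet.iUnion fun a => ?_
      rw [hpre]
      exact (hpm a).subtype_image ((e a).measurable (measurable_subtype_coe hS))
    refine ⟨hmeas, Measure.ext fun S hS => ?_⟩
    have hdisj : ∀ (r : USq → ℕ) (S : Set USq),
        Pairwise (Function.onFun Disjoint fun a => r ⁻¹' {a} ∩ S) := by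
      intro r S a b hab
      refine Set.disjoint_left.mpr ?_
      rintro u ⟨rfl, -⟩ ⟨rfl, -⟩
      exact hab rfl
    rw [Measure.map_apply hmeas hS]
    conv_lhs => rw [hun p (_ ⁻¹' S)]
    conv_rhs => rw [hun q S]
    rw [measure_iUnion (hdisj _ _) fun a => (hpm a).inter (hmeas hS),
      measure_iUnion (hdisj _ _) fun a => (hqm a).inter hS]
    congr 1
    ext a
    have hS' : MeasurableSet (Subtype.val ⁻¹' S : Set (q ⁻¹' {a})) := measurable_subtype_coe hS
    have h := (he a).measure_preimage hS'.nullMeasurableSet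
    rw [comap_subtype_coe_apply (hpm a), comap_subtype_coe_apply (hqm a),
      Subtype.image_preimage_coe] at h
    rw [hpre, h]
  have hfq : ∀ u, q (e (p u) ⟨u, rfl⟩ : USq) = p u := fun u => (e (p u) ⟨u, rfl⟩).2
  have hgp : ∀ u, p ((e (q u)).symm ⟨u, rfl⟩ : USq) = q u := fun u => ((e (q u)).symm ⟨u, rfl⟩).2
  have aux : ∀ {r s : USq → ℕ} (d : ∀ a, (r ⁻¹' {a}) ≃ᵐ (s ⁻¹' {a})) (a : ℕ)
      (v : s ⁻¹' {a}), ((d (s v)).symm ⟨v, rfl⟩ : USq) = (d a).symm v := by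
    rintro r s d a ⟨v, rfl⟩
    rfl
  refine ⟨_, ⟨glue hp hq e he, _, glue hq hp (fun a => (e a).symm) (fun a => (he a).symm _),
    ?_, ?_⟩,
    hfq⟩
  · intro u
    refine (aux e (p u) (e (p u) ⟨u, rfl⟩)).trans ?_
    simp
  · intro u
    refine (aux (fun a => (e a).symm) (q u) ((e (q u)).symm ⟨u, rfl⟩)).trans ?_
    simp

lemma integrable_of_measurable_of_abs_le {X : Type*} [MeasurableSpace X] {μ : Measure X}
    [IsFiniteMeasure μ] {f : X → ℝ} (hf : Measurable f) {C : ℝ} (hC : ∀ x, |f x| ≤ C) :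
    Integrable f μ :=
  Integrable.of_bound hf.aestronglyMeasurable C (Eventually.of_forall hC)

lemma measurable_step {L : USq → ℕ} (hL : Measurable L) (g : ℕ → ℕ → ℝ) :
    Measurable fun p : USq × USq => g (L p.1) (L p.2) :=
  (measurable_of_countable fun q : ℕ × ℕ => g q.1 q.2).comp
    ((hL.comp measurable_fst).prodMk (hL.comp measurable_snd))

lemma abs_sub_le_one_of_mem_Icc {a b : ℝ} (ha : a ∈ Icc (0 : ℝ) 1) (hb : b ∈ Icc (0 : ℝ) 1) :
    |a - b| ≤ 1 :=
  abs_le.mpr ⟨by linarith [ha.1, hb.2], by linarith [ha.2, hb.1]⟩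

lemma label_digits (n : ℕ) (P Q : Prop) :
    (4 * n + ((if P then 2 else 0) + if Q then 1 else 0)) / 4 = n ∧
    (2 ≤ (4 * n + ((if P then 2 else 0) + if Q then 1 else 0)) % 4 ↔ P) ∧
    ((4 * n + ((if P then 2 else 0) + if Q then 1 else 0)) % 2 = 1 ↔ Q) := by
  refine ⟨?_, ?_, ?_⟩ <;> by_cases hP : P <;> by_cases hQ : Q <;>
    simp only [hP, hQ, if_true, if_false, iff_true, iff_false] <;> omega

/-- Clamping to the unit interval does not increase the distance to a point of it. -/
lemma sq_sub_clamp_le {w z : ℝ} (hw : w ∈ Icc (0 : ℝ) 1) :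
    (w - max 0 (min 1 z)) ^ 2 ≤ (w - z) ^ 2 := by
  obtain ⟨w0, w1⟩ := hw
  rw [sq_le_sq]
  rcases le_total 1 z with h | h
  · rw [min_eq_left h, max_eq_right zero_le_one, abs_of_nonpos (by linarith),
      abs_of_nonpos (by linarith)]
    linarith
  · rw [min_eq_right h]
    rcases le_total 0 z with h' | h'
    · rw [max_eq_right h']
    · rw [max_eq_left h', abs_of_nonneg (by linarith), abs_of_nonneg (by linarith)]
      linarith

/-- One step of the energy decrement: a pair of sets witnessing a large cut refines the labelling
and decreases the squared distance. -/
lemma exists_refinement {W : USq → USq → ℝ} (hW : IsOrderon W) {K : ℕ} {L : USq → ℕ}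
    (hL : Measurable L) (hLK : ∀ u, L u < K) {g : ℕ → ℕ → ℝ} (hg : ∀ a b, g a b ∈ Icc (0 : ℝ) 1)
    {S T : Set USq} (hS : MeasurableSet S) (hT : MeasurableSet T) :
    ∃ (L' : USq → ℕ) (g' : ℕ → ℕ → ℝ), Measurable L' ∧ (∀ u, L' u < 4 * K) ∧
      (∀ a b, g' a b ∈ Icc (0 : ℝ) 1) ∧ (∀ a b, g' a b = g' b a) ∧
      ∫ p : USq × USq, (W p.1 p.2 - g' (L' p.1) (L' p.2)) ^ 2 ≤
        (∫ p : USq × USq, (W p.1 p.2 - g (L p.1) (L p.2)) ^ 2) -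
          (∫ p in S ×ˢ T, (W p.1 p.2 - g (L p.1) (L p.2))) ^ 2 := by
  obtain ⟨hWm, hW01, hWs⟩ := hW
  set D : USq × USq → ℝ := fun p => W p.1 p.2 - g (L p.1) (L p.2) with hD
  have hWm' : Measurable fun p : USq × USq => W p.1 p.2 := hWm
  have hDm : Measurable D := hWm'.sub (measurable_step hL g)
  have hD1 : ∀ p, |D p| ≤ 1 := fun p => abs_sub_le_one_of_mem_Icc (hW01 _ _) (hg _ _)
  set I : ℝ := ∫ p in S ×ˢ T, D p with hI
  let L' : USq → ℕ := fun u => 4 * L u + ((if u ∈ S then 2 else 0) + if u ∈ T then 1 else 0)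
  let h : ℕ → ℕ → ℝ := fun a b =>
    g (a / 4) (b / 4) + if 2 ≤ a % 4 ∧ b % 2 = 1 then I else 0
  let g' : ℕ → ℕ → ℝ := fun a b => max 0 (min 1 ((h a b + h b a) / 2))
  have hST : MeasurableSet (S ×ˢ T) := hS.prod hT
  have hLmeas : Measurable L' :=
    (hL.const_mul 4).add ((Measurable.ite hS measurable_const measurable_const).add
      (Measurable.ite hT measurable_const measurable_const))
  have hLdiv : ∀ u, L' u / 4 = L u := fun u => (label_digits _ _ _).1
  have hLS : ∀ u, 2 ≤ L' u % 4 ↔ u ∈ S := fun u => (label_digits _ _ _).2.1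
  have hLT : ∀ u, L' u % 2 = 1 ↔ u ∈ T := fun u => (label_digits _ _ _).2.2
  set χ : USq × USq → ℝ := (S ×ˢ T).indicator 1 with hχ
  have hχm : Measurable χ := measurable_one.indicator hST
  have hχ01 : ∀ p, 0 ≤ χ p ∧ χ p ≤ 1 := by
    intro p
    by_cases hp : p ∈ S ×ˢ T <;> simp [hχ, hp]
  have hχh : ∀ p : USq × USq, h (L' p.1) (L' p.2) = g (L p.1) (L p.2) + I * χ p := by
    intro p
    simp only [h, hLdiv, hLS, hLT, ← Set.mem_prod]
    by_cases hp : p ∈ S ×ˢ T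
    · rw [if_pos hp]; simp [hχ, hp]
    · rw [if_neg hp]; simp [hχ, hp]
  have hI1 : |I| ≤ 1 := by
    have := norm_setIntegral_le_of_norm_le_const (μ := (volume : Measure (USq × USq)))
      (s := S ×ˢ T) (f := D) (C := 1) (measure_lt_top _ _) fun p _ => hD1 p
    refine this.trans ?_
    simp
  have hint : ∀ f : USq × USq → ℝ, Measurable f → (∀ p, |f p| ≤ 4) → Integrable f := fun f hf hb =>
    integrable_of_measurable_of_abs_le hf hb
  have hχint : ∫ p, χ p ≤ 1 := by
    rw [hχ, integral_indicator_one hST]; exact measureReal_le_one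
  have hDχ : ∫ p, D p * χ p = I := by
    rw [hI, ← integral_indicator hST]
    congr 1; ext p
    by_cases hp : p ∈ S ×ˢ T <;> simp [hχ, hp]
  have hD2i : Integrable fun p => D p ^ 2 := hint _ (hDm.pow_const 2) fun p => by
    rw [abs_pow]; nlinarith [hD1 p, abs_nonneg (D p)]
  have hDχi : Integrable fun p => D p * χ p := hint _ (hDm.mul hχm) fun p => by
    rw [abs_mul, abs_of_nonneg (hχ01 p).1]; nlinarith [hD1 p, abs_nonneg (D p), hχ01 p]
  have hχi : Integrable χ := hint _ hχm fun p => by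
    rw [abs_of_nonneg (hχ01 p).1]; linarith [(hχ01 p).2]
  let E : USq × USq → ℝ := fun p => D p - I * χ p
  have hEm : Measurable E := hDm.sub (hχm.const_mul I)
  have hE2i : Integrable fun p => E p ^ 2 := hint _ (hEm.pow_const 2) fun p => by
    have h1 : |I * χ p| ≤ 1 := by
      rw [abs_mul, abs_of_nonneg (hχ01 p).1]; nlinarith [abs_nonneg I, hχ01 p]
    have h2 : |E p| ≤ 2 := (abs_sub _ _).trans (by linarith [hD1 p])
    rw [abs_pow]; nlinarith [abs_nonneg (E p)]
  have hE2 : ∫ p, E p ^ 2 ≤ (∫ p, D p ^ 2) - I ^ 2 := by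
    have h1 : ∀ p, E p ^ 2 = D p ^ 2 - 2 * I * (D p * χ p) + I ^ 2 * χ p := by
      intro p
      have : χ p ^ 2 = χ p := by
        by_cases hp : p ∈ S ×ˢ T <;> simp [hχ, hp]
      simp only [E]; linear_combination I ^ 2 * this
    have h2 : Integrable fun p => D p ^ 2 - 2 * I * (D p * χ p) := hD2i.sub (hDχi.const_mul _)
    simp_rw [h1]
    rw [integral_add h2 (hχi.const_mul _), integral_sub hD2i (hDχi.const_mul _),
      integral_const_mul, integral_const_mul, hDχ]
    nlinarith [sq_nonneg I]
  have hswap : MeasurePreserving (Prod.swap : USq × USq → USq × USq) volume volume :=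
    Measure.measurePreserving_swap
  have hE2si : Integrable fun p : USq × USq => E p.swap ^ 2 :=
    hswap.integrable_comp_of_integrable hE2i
  have hE2s : ∫ p : USq × USq, E p.swap ^ 2 = ∫ p, E p ^ 2 :=
    hswap.integral_comp (MeasurableEquiv.prodComm.measurableEmbedding) fun p => E p ^ 2
  have hgUnit : ∀ a b, g' a b ∈ Icc (0 : ℝ) 1 := fun a b =>
    ⟨le_max_left _ _, max_le zero_le_one (min_le_left _ _)⟩
  have hpt : ∀ p : USq × USq, (W p.1 p.2 - g' (L' p.1) (L' p.2)) ^ 2 ≤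
      (E p ^ 2 + E p.swap ^ 2) / 2 := by
    intro p
    have h1 : E p = W p.1 p.2 - h (L' p.1) (L' p.2) := by
      simp only [E, D, hχh]; ring
    have h2 : E p.swap = W p.1 p.2 - h (L' p.2) (L' p.1) := by
      have := hχh p.swap
      simp only [Prod.fst_swap, Prod.snd_swap] at this
      simp only [E, D, this, hWs p.1 p.2, Prod.fst_swap, Prod.snd_swap]; ring
    rw [h1, h2]
    obtain ⟨w0, w1⟩ := hW01 p.1 p.2
    generalize W p.1 p.2 = w at *
    simp only [g']
    generalize h (L' p.1) (L' p.2) = x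
    generalize h (L' p.2) (L' p.1) = y
    have h3 := sq_sub_clamp_le (z := (x + y) / 2) ⟨w0, w1⟩
    nlinarith [sq_nonneg (x - y)]
  refine ⟨L', g', hLmeas, ?_, hgUnit, fun a b => by simp only [g']; rw [add_comm], ?_⟩
  · intro u
    exact (Nat.div_lt_iff_lt_mul (by norm_num)).mp (by rw [hLdiv u]; exact hLK u)
      |>.trans_eq (mul_comm _ _)
  · calc _ ≤ ∫ p : USq × USq, (E p ^ 2 + E p.swap ^ 2) / 2 := by
          refine integral_mono (hint _ ((hWm'.sub (measurable_step hLmeas g')).pow_const 2)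
            fun p => ?_)
            ((hE2i.add hE2si).div_const 2) hpt
          have := abs_sub_le_one_of_mem_Icc (hW01 p.1 p.2) (hgUnit (L' p.1) (L' p.2))
          rw [abs_pow]; nlinarith [abs_nonneg (W p.1 p.2 - g' (L' p.1) (L' p.2))]
      _ = ∫ p, E p ^ 2 := by
          rw [integral_div, integral_add hE2i hE2si, hE2s]; ring
      _ ≤ _ := hE2

lemma exists_step_of_energy_le {W : USq → USq → ℝ} (hW : IsOrderon W) {δ : ℝ} (hδ : 0 < δ)
    (s : ℕ) : ∀ (K : ℕ) (L : USq → ℕ) (g : ℕ → ℕ → ℝ), Measurable L → (∀ u, L u < K) →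
      (∀ a b, g a b ∈ Icc (0 : ℝ) 1) → (∀ a b, g a b = g b a) →
      ∫ p : USq × USq, (W p.1 p.2 - g (L p.1) (L p.2)) ^ 2 ≤ s * δ ^ 2 →
      ∃ (L' : USq → ℕ) (g' : ℕ → ℕ → ℝ), Measurable L' ∧ (∀ u, L' u < 4 ^ s * K) ∧
        (∀ a b, g' a b ∈ Icc (0 : ℝ) 1) ∧ (∀ a b, g' a b = g' b a) ∧
        ∀ S T : Set USq, MeasurableSet S → MeasurableSet T →
          |∫ p in S ×ˢ T, (W p.1 p.2 - g' (L' p.1) (L' p.2))| ≤ δ := by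
  induction s with
  | zero =>
    intro K L g hL hLK hg hgs hE
    refine ⟨L, g, hL, by simpa using hLK, hg, hgs, fun S T hS hT => ?_⟩
    obtain ⟨L', g', -, -, -, -, h⟩ := exists_refinement hW hL hLK hg hS hT
    have h0 : 0 ≤ ∫ p : USq × USq, (W p.1 p.2 - g' (L' p.1) (L' p.2)) ^ 2 :=
      integral_nonneg fun p => sq_nonneg _
    simp only [Nat.cast_zero, zero_mul] at hE
    refine abs_le_of_sq_le_sq ?_ hδ.le
    nlinarith [sq_nonneg δ]
  | succ s ih =>
    intro K L g hL hLK hg hgs hE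
    by_cases hcut : ∀ S T : Set USq, MeasurableSet S → MeasurableSet T →
        |∫ p in S ×ˢ T, (W p.1 p.2 - g (L p.1) (L p.2))| ≤ δ
    · exact ⟨L, g, hL, fun u => (hLK u).trans_le (Nat.le_mul_of_pos_left _ (by positivity)), hg,
        hgs, hcut⟩
    · push Not at hcut
      obtain ⟨S, T, hS, hT, hlt⟩ := hcut
      obtain ⟨L', g', hL', hLK', hg', hgs', h⟩ := exists_refinement hW hL hLK hg hS hT
      have hsq : δ ^ 2 ≤ (∫ p in S ×ˢ T, (W p.1 p.2 - g (L p.1) (L p.2))) ^ 2 := by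
        rw [← sq_abs (∫ p in S ×ˢ T, _)]
        exact pow_le_pow_left₀ hδ.le hlt.le 2
      have := ih (4 * K) L' g' hL' hLK' hg' hgs' (by push_cast at hE; linarith)
      rwa [show 4 ^ s * (4 * K) = 4 ^ (s + 1) * K by ring] at this

/-- Weak regularity for orderons. -/
lemma exists_step_approximation {W : USq → USq → ℝ} (hW : IsOrderon W) {δ : ℝ} (hδ : 0 < δ)
    {s : ℕ} (hs : 1 ≤ s * δ ^ 2) :
    ∃ (L : USq → ℕ) (g : ℕ → ℕ → ℝ), Measurable L ∧ (∀ u, L u < 4 ^ s) ∧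
      (∀ a b, g a b ∈ Icc (0 : ℝ) 1) ∧ (∀ a b, g a b = g b a) ∧
      ∀ S T : Set USq, MeasurableSet S → MeasurableSet T →
        |∫ p in S ×ˢ T, (W p.1 p.2 - g (L p.1) (L p.2))| ≤ δ := by
  have h := exists_step_of_energy_le hW hδ s 1 (fun _ => 0) (fun _ _ => 0) measurable_const
    (by simp) (by simp) (by simp) (by
      refine le_trans ?_ hs
      have hb : ∀ p : USq × USq, ‖(W p.1 p.2 - 0) ^ 2‖ ≤ 1 := fun p => by
        obtain ⟨h0, h1⟩ := hW.2.1 p.1 p.2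
        rw [sub_zero, Real.norm_eq_abs, abs_pow, abs_of_nonneg h0]; nlinarith
      have := norm_integral_le_of_norm_le_const (μ := (volume : Measure (USq × USq)))
        (Eventually.of_forall hb)
      simpa using (le_abs_self _).trans this)
  simpa using h

lemma volume_real_fst_le {c : ℝ} (h0 : 0 ≤ c) (h1 : c ≤ 1) :
    (volume : Measure USq).real {v | (v.1 : ℝ) ≤ c} = c := by
  have hfst : MeasurePreserving (Prod.fst : USq → UI) volume volume := measurePreserving_fst
  have := hfst.measure_preimage (measurableSet_Iic (a := (⟨c, h0, h1⟩ : UI))).nullMeasurableSet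
  rw [unitInterval.volume_Iic] at this
  exact (congrArg ENNReal.toReal this).trans (ENNReal.toReal_ofReal h0)

/-- A measure-preserving ranking function compatible with a given labelling. -/
lemma exists_ranking {N : USq → ℕ} (hN : Measurable N) :
    ∃ T : USq → UI, MeasurePreserving T volume volume ∧
      ∀ u, (volume : Measure USq).real {v | N v < N u} ≤ T u ∧
        (T u : ℝ) ≤ (volume : Measure USq).real {v | N v ≤ N u} := by
  let Ψ : USq → ℝ := fun u => N u + (u.2 : ℝ) / 2
  have hΨ : Measurable Ψ :=
    ((measurable_of_countable fun n : ℕ => (n : ℝ)).comp hN).add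
      ((measurable_subtype_coe.comp measurable_snd).div_const 2)
  have : IsProbabilityMeasure (volume.map Ψ) := Measure.isProbabilityMeasure_map hΨ.aemeasurable
  have : NullSingletonClass (volume.map Ψ) := ⟨fun x => by
    rw [Measure.map_apply hΨ (measurableSet_singleton x)]
    have hsub : Ψ ⁻¹' {x} ⊆ ⋃ n : ℕ, Prod.snd ⁻¹' {y : UI | (n : ℝ) + (y : ℝ) / 2 = x} := by
      intro u hu
      exact mem_iUnion.mpr ⟨N u, hu⟩
    refine measure_mono_null hsub (measure_iUnion_null fun n => ?_)
    refine Measure.quasiMeasurePreserving_snd.preimage_null (Set.Subsingleton.measure_zero ?_ _)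
    intro y hy z hz
    have hy' : (n : ℝ) + (y : ℝ) / 2 = x := hy
    have hz' : (n : ℝ) + (z : ℝ) / 2 = x := hz
    exact Subtype.ext (by linarith)⟩
  refine ⟨fun u => cdfUI (volume.map Ψ) (Ψ u),
    (measurePreserving_cdfUI _).comp (hΨ.measurePreserving volume), fun u => ?_⟩
  have hT : ((cdfUI (volume.map Ψ) (Ψ u) : UI) : ℝ) =
      (volume : Measure USq).real {v | Ψ v ≤ Ψ u} := by
    refine (cdf_eq_real _ _).trans ?_
    rw [map_measureReal_apply hΨ measurableSet_Iic]
    rfl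
  rw [hT]
  constructor
  · refine measureReal_mono fun v (hv : N v < N u) => ?_
    have h1 : (N v : ℝ) + 1 ≤ N u := by exact_mod_cast hv
    have := v.2.2.2
    have := u.2.2.1
    change (N v : ℝ) + (v.2 : ℝ) / 2 ≤ N u + (u.2 : ℝ) / 2
    linarith
  · refine measureReal_mono fun v (hv : Ψ v ≤ Ψ u) => ?_
    have h1 := v.2.2.1
    have h2 := u.2.2.2
    simp only [Ψ] at hv
    have h3 : (N v : ℝ) < N u + 1 := by linarith
    exact Nat.lt_succ_iff.mp (by exact_mod_cast h3)

lemma one_le_Qn (n : ℕ) (x : ℝ) : 1 ≤ Qn n x := le_max_left _ _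

lemma Qn_mono (n : ℕ) {x y : ℝ} (h : x ≤ y) : Qn n x ≤ Qn n y :=
  max_le_max le_rfl (Nat.ceil_mono (mul_le_mul_of_nonneg_left h n.cast_nonneg))

lemma measurable_Qn (n : ℕ) : Measurable (Qn n) :=
  measurable_const.max (Nat.measurable_ceil.comp (measurable_const_mul _))

lemma Qn_le_iff {n a : ℕ} (hn : 0 < n) (ha : 1 ≤ a) {x : ℝ} : Qn n x ≤ a ↔ x ≤ a / n := by
  have hn' : (0 : ℝ) < n := Nat.cast_pos.mpr hn
  rw [Qn, max_le_iff, Nat.ceil_le, le_div_iff₀ hn', mul_comm]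
  exact ⟨And.right, fun h => ⟨ha, h⟩⟩

lemma Qn_le {n : ℕ} (hn : 0 < n) {x : ℝ} (hx : x ≤ 1) : Qn n x ≤ n :=
  (Qn_le_iff hn hn).mpr (by rwa [div_self (Nat.cast_ne_zero.mpr hn.ne')])

lemma le_Qn_div {n : ℕ} (hn : 0 < n) (x : ℝ) : x ≤ Qn n x / n :=
  (Qn_le_iff hn (one_le_Qn n x)).mp le_rfl

lemma Qn_sub_one_div_le {n : ℕ} (hn : 0 < n) {x : ℝ} (hx : 0 ≤ x) : ((Qn n x : ℝ) - 1) / n ≤ x := by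
  rcases (one_le_Qn n x).eq_or_lt with h | h
  · rw [← h]; simpa using hx
  · have h1 : ¬ Qn n x ≤ Qn n x - 1 := by omega
    rw [Qn_le_iff hn (by omega), not_le, Nat.cast_sub h.le, Nat.cast_one] at h1
    exact h1.le

lemma abs_sub_le_of_Qn_eq {n : ℕ} (hn : 0 < n) {x y : ℝ} (hx : 0 ≤ x) (hy : 0 ≤ y)
    (h : Qn n x = Qn n y) : |x - y| ≤ 1 / n := by
  have h1 := le_Qn_div hn x
  have h2 := le_Qn_div hn y
  have h3 := Qn_sub_one_div_le hn hx
  have h4 := Qn_sub_one_div_le hn hy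
  rw [h] at h1 h3
  rw [sub_div] at h3 h4
  exact abs_le.mpr ⟨by linarith, by linarith⟩

lemma volume_Qn_cell {n a : ℕ} (hn : 0 < n) (ha : 1 ≤ a) (han : a ≤ n) :
    (volume : Measure UI) {x | Qn n (x : ℝ) = a} = ENNReal.ofReal (1 / n) := by
  have hn' : (0 : ℝ) < n := Nat.cast_pos.mpr hn
  have ha' : (1 : ℝ) ≤ a := Nat.one_le_cast.mpr ha
  have han' : (a : ℝ) ≤ n := Nat.cast_le.mpr han
  let lo : UI := ⟨((a : ℝ) - 1) / n, div_nonneg (by linarith) hn'.le,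
    (div_le_one hn').mpr (by linarith)⟩
  let hi : UI := ⟨(a : ℝ) / n, div_nonneg (by linarith) hn'.le, (div_le_one hn').mpr han'⟩
  have hlen : (hi : ℝ) - lo = 1 / n := by simp only [hi, lo]; ring
  refine le_antisymm ?_ ?_
  · rw [← hlen, ← unitInterval.volume_Icc]
    refine measure_mono ?_
    rintro x rfl
    exact ⟨Qn_sub_one_div_le hn x.2.1, le_Qn_div hn x⟩
  · rw [← hlen, ← unitInterval.volume_Ioo]
    refine measure_mono ?_
    rintro x ⟨hx1, hx2⟩
    have hx1' : ((a : ℝ) - 1) / n < x := hx1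
    have h2 : Qn n (x : ℝ) ≤ a := (Qn_le_iff hn ha).mpr (le_of_lt hx2)
    refine le_antisymm h2 (not_lt.mp fun h => ?_)
    have h3 : 2 ≤ a := (Nat.succ_le_succ (one_le_Qn n x)).trans h
    have h4 : Qn n (x : ℝ) ≤ a - 1 := Nat.le_pred_of_lt h
    rw [Qn_le_iff hn (by omega), Nat.cast_sub ha, Nat.cast_one] at h4
    linarith

lemma exists_rearrangement {m k n : ℕ} (hm : 0 < m) (hn : 0 < n) {L : USq → ℕ}
    (hL : Measurable L) (hLk : ∀ u, L u < k) :
    ∃ (f : USq → USq) (σ : ℕ → ℕ) (B : Set USq), IsMPB f ∧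
      (∀ u, |(u.1 : ℝ) - (f u).1| ≤ 1 / m + 1 / n) ∧ MeasurableSet B ∧
      (volume : Measure USq).real B ≤ m * k / n ∧
      (Measurable fun u => Qn n ((f u).1 : ℝ)) ∧
      ∀ u, u ∉ B → σ (Qn n ((f u).1 : ℝ)) = L u := by
  have hm' : (0 : ℝ) < m := Nat.cast_pos.mpr hm
  let b : USq → ℕ := fun u => Qn m (u.1 : ℝ)
  have hbm : Measurable b :=
    (measurable_Qn m).comp (measurable_subtype_coe.comp measurable_fst)
  let N : USq → ℕ := fun u => (b u - 1) * k + L u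
  have hNm : Measurable N :=
    ((measurable_of_countable fun i : ℕ => (i - 1) * k).comp hbm).add hL
  have hNmod : ∀ u, N u % k = L u := fun u => by
    simp only [N]; rw [Nat.mul_add_mod_self_right, Nat.mod_eq_of_lt (hLk u)]
  have hNdiv : ∀ u, N u / k = b u - 1 := fun u => by
    have hk : 0 < k := (Nat.zero_le _).trans_lt (hLk u)
    simp only [N]
    rw [add_comm, Nat.add_mul_div_right _ _ hk, Nat.div_eq_of_lt (hLk u), zero_add]
  have hb1 : ∀ u, 1 ≤ b u := fun u => one_le_Qn _ _
  have hNlt : ∀ u, N u < m * k := fun u => by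
    have hk : 0 < k := (Nat.zero_le _).trans_lt (hLk u)
    rw [← Nat.div_lt_iff_lt_mul hk, hNdiv]
    have : b u ≤ m := Qn_le hm u.1.2.2
    have := hb1 u
    omega
  obtain ⟨T, hT, hTN⟩ := exists_ranking hNm
  have hTb : ∀ u, |(u.1 : ℝ) - T u| ≤ 1 / m := by
    intro u
    have hub : (b u : ℝ) ≤ m := Nat.cast_le.mpr (Qn_le hm u.1.2.2)
    have hb1' : (1 : ℝ) ≤ b u := Nat.one_le_cast.mpr (hb1 u)
    have h1 : (T u : ℝ) ≤ b u / m := by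
      rw [← volume_real_fst_le (c := (b u : ℝ) / m) (by positivity) ((div_le_one hm').mpr hub)]
      refine (hTN u).2.trans (measureReal_mono fun v (hv : N v ≤ N u) => ?_)
      have hbv : b v - 1 ≤ b u - 1 := by
        rw [← hNdiv, ← hNdiv]; exact Nat.div_le_div_right hv
      have := hb1 v
      have := hb1 u
      exact (Qn_le_iff hm (hb1 u)).mp (show b v ≤ b u by omega)
    have h2 : ((b u : ℝ) - 1) / m ≤ T u := by
      rcases (hb1 u).eq_or_lt with h | h
      · rw [← h]; simpa using (T u).2.1
      rw [← volume_real_fst_le (c := ((b u : ℝ) - 1) / m) (div_nonneg (by linarith) hm'.le)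
        ((div_le_one hm').mpr (by linarith))]
      refine (measureReal_mono fun v hv => ?_).trans (hTN u).1
      have hv' : (v.1 : ℝ) ≤ ((b u - 1 : ℕ) : ℝ) / m := by
        rw [Nat.cast_sub h.le, Nat.cast_one]; exact hv
      have hbv : b v ≤ b u - 1 := (Qn_le_iff hm (by omega)).mpr hv'
      change N v < N u
      refine lt_of_not_ge fun hle => ?_
      have h3 : b u - 1 ≤ b v - 1 := by
        rw [← hNdiv, ← hNdiv]; exact Nat.div_le_div_right hle
      have := hb1 v
      omega
    have h3 : (u.1 : ℝ) ≤ b u / m := le_Qn_div hm _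
    have h4 : ((b u : ℝ) - 1) / m ≤ u.1 := Qn_sub_one_div_le hm u.1.2.1
    rw [sub_div] at h2 h4
    exact abs_le.mpr ⟨by linarith, by linarith⟩
  let p : USq → ℕ := fun u => Qn n (T u : ℝ)
  let q : USq → ℕ := fun u => Qn n (u.1 : ℝ)
  have hQm : Measurable fun x : UI => Qn n (x : ℝ) := (measurable_Qn n).comp measurable_subtype_coe
  have hpm : Measurable p := hQm.comp hT.measurable
  have hqm : Measurable q := hQm.comp measurable_fst
  have hfst : MeasurePreserving (Prod.fst : USq → UI) volume volume := measurePreserving_fst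
  have hp : ∀ a, volume (p ⁻¹' {a}) = volume {x : UI | Qn n (x : ℝ) = a} := fun a =>
    hT.measure_preimage (hQm (measurableSet_singleton a)).nullMeasurableSet
  have hq : ∀ a, volume (q ⁻¹' {a}) = volume {x : UI | Qn n (x : ℝ) = a} := fun a =>
    hfst.measure_preimage (hQm (measurableSet_singleton a)).nullMeasurableSet
  have hcell : ∀ x : UI, volume {y : UI | Qn n (y : ℝ) = Qn n (x : ℝ)} = ENNReal.ofReal (1 / n) :=
    fun x => volume_Qn_cell hn (one_le_Qn _ _) (Qn_le hn x.2.2)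
  have hpos : ENNReal.ofReal (1 / n) ≠ 0 := by
    rw [ne_eq, ENNReal.ofReal_eq_zero, not_le]; positivity
  obtain ⟨f, hf, hfp⟩ := exists_isMPB_of_fibers hpm hqm (fun a => (hp a).trans (hq a).symm)
    (fun u => by rw [hp, hcell]; exact hpos) (fun u => by rw [hq, hcell]; exact hpos)
  have hfp' : ∀ u, Qn n ((f u).1 : ℝ) = p u := hfp
  let τ : ℕ → UI := fun i => ⟨(volume : Measure USq).real {v | N v ≤ i}, measureReal_nonneg,
    measureReal_le_one⟩
  let B : Set USq := ⋃ i ∈ Finset.range (m * k), p ⁻¹' {Qn n (τ i : ℝ)}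
  have hsame : ∀ u u', p u = p u' → N u < N u' → p u = Qn n (τ (N u) : ℝ) := by
    intro u u' h hlt
    refine le_antisymm (Qn_mono n (hTN u).2) ?_
    rw [h]
    refine Qn_mono n (le_trans (measureReal_mono fun v (hv : N v ≤ N u) => ?_) (hTN u').1)
    exact lt_of_le_of_lt hv hlt
  have hmemB : ∀ u i, i < m * k → p u = Qn n (τ i : ℝ) → u ∈ B := fun u i hi h =>
    mem_biUnion (Finset.mem_coe.mpr (Finset.mem_range.mpr hi)) h
  refine ⟨f, fun a => if h : ∃ u, p u = a then L h.choose else 0, B, hf, fun u => ?_,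
    Finset.measurableSet_biUnion _ fun i _ => hpm (measurableSet_singleton _), ?_, ?_, ?_⟩
  · have h1 := abs_sub_le_of_Qn_eq hn (T u).2.1 (f u).1.2.1 (hfp' u).symm
    exact (abs_sub_le _ (T u : ℝ) _).trans (add_le_add (hTb u) h1)
  · refine (measureReal_biUnion_finset_le _ _).trans ?_
    have : ∀ i ∈ Finset.range (m * k),
        (volume : Measure USq).real (p ⁻¹' {Qn n (τ i : ℝ)}) = 1 / n := fun i _ => by
      rw [Measure.real, hp, hcell, ENNReal.toReal_ofReal (by positivity)]
    rw [Finset.sum_congr rfl this]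
    simp [div_eq_mul_inv]
  · simp_rw [hfp']; exact hpm
  · intro u hu
    have hex : ∃ u', p u' = p u := ⟨u, rfl⟩
    simp only [hfp']
    rw [dif_pos hex]
    have hc := hex.choose_spec
    rw [← hNmod, ← hNmod u]
    congr 1
    by_contra hne
    rcases lt_or_gt_of_ne hne with hlt | hlt
    · exact hu (hmemB u _ (hNlt _) (hc.symm.trans (hsame _ _ hc hlt)))
    · exact hu (hmemB u _ (hNlt _) (hsame _ _ hc.symm hlt))

/-- Step functions whose labels agree off a small set have small cuts between them. -/
lemma abs_setIntegral_step_sub_le {L M : USq → ℕ} (hL : Measurable L) (hM : Measurable M)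
    {g : ℕ → ℕ → ℝ} (hg : ∀ a b, g a b ∈ Icc (0 : ℝ) 1) {B : Set USq} (hB : MeasurableSet B)
    (hLM : ∀ u, u ∉ B → M u = L u) (A : Set (USq × USq)) :
    |∫ p in A, (g (L p.1) (L p.2) - g (M p.1) (M p.2))| ≤
      2 * (volume : Measure USq).real B := by
  set d : USq × USq → ℝ := fun p => g (L p.1) (L p.2) - g (M p.1) (M p.2) with hd
  have hdm : Measurable d := (measurable_step hL g).sub (measurable_step hM g)
  have hd1 : ∀ p, |d p| ≤ 1 := fun p => abs_sub_le_one_of_mem_Icc (hg _ _) (hg _ _)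
  have hdi : Integrable d := integrable_of_measurable_of_abs_le hdm hd1
  set C : Set (USq × USq) := Prod.fst ⁻¹' B ∪ Prod.snd ⁻¹' B with hC
  have hCm : MeasurableSet C := (measurable_fst hB).union (measurable_snd hB)
  have hdC : ∀ p, |d p| ≤ C.indicator 1 p := by
    intro p
    by_cases hp : p ∈ C
    · simpa [hp] using hd1 p
    · have h1 : p.1 ∉ B := fun h => hp (Or.inl h)
      have h2 : p.2 ∉ B := fun h => hp (Or.inr h)
      simp [hp, hd, hLM _ h1, hLM _ h2]
  have hfst : (volume : Measure (USq × USq)).real (Prod.fst ⁻¹' B) =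
      (volume : Measure USq).real B :=
    measurePreserving_fst.measureReal_preimage hB.nullMeasurableSet
  have hsnd : (volume : Measure (USq × USq)).real (Prod.snd ⁻¹' B) =
      (volume : Measure USq).real B :=
    measurePreserving_snd.measureReal_preimage hB.nullMeasurableSet
  calc |∫ p in A, d p| ≤ ∫ p in A, |d p| := abs_integral_le_integral_abs
    _ ≤ ∫ p, |d p| :=
        setIntegral_le_integral hdi.abs (Eventually.of_forall fun p => abs_nonneg _)
    _ ≤ ∫ p, C.indicator 1 p :=
        integral_mono hdi.abs ((integrable_const (1 : ℝ)).indicator hCm) hdC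
    _ = (volume : Measure (USq × USq)).real C := integral_indicator_one hCm
    _ ≤ _ := by
        refine (measureReal_union_le _ _).trans ?_
        rw [hfst, hsnd, two_mul]

lemma cutNorm_nonneg (W : USq → USq → ℝ) : 0 ≤ cutNorm W := by
  refine Real.sSup_nonneg ?_
  rintro x ⟨S, T, -, -, rfl⟩
  exact abs_nonneg _

lemma shiftOf_nonneg (f : USq → USq) : 0 ≤ shiftOf f := Real.iSup_nonneg fun _ => abs_nonneg _

lemma csDist_le {W U : USq → USq → ℝ} {f : USq → USq} (hf : IsMPB f) {a b : ℝ} (hb : 0 ≤ b)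
    (ha : ∀ u, |(u.1 : ℝ) - (f u).1| ≤ a)
    (hcut : ∀ S T : Set USq, MeasurableSet S → MeasurableSet T →
      |∫ p in S ×ˢ T, (W p.1 p.2 - U (f p.1) (f p.2))| ≤ b) :
    csDist W U ≤ a + b := by
  have hbdd : BddBelow {x : ℝ | ∃ f : USq → USq, IsMPB f ∧
      x = shiftOf f + cutNorm (fun u v => W u v - U (f u) (f v))} :=
    ⟨0, by rintro x ⟨f, -, rfl⟩; exact add_nonneg (shiftOf_nonneg _) (cutNorm_nonneg _)⟩
  have hmem : csDist W U ≤ shiftOf f + cutNorm (fun u v => W u v - U (f u) (f v)) :=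
    csInf_le hbdd ⟨f, hf, rfl⟩
  refine hmem.trans (add_le_add (ciSup_le ha) (Real.sSup_le ?_ hb))
  · rintro x ⟨S, T, hS, hT, rfl⟩
    exact hcut S T hS hT

/-- Density of block orderons, with explicit parameters. -/
lemma exists_csDist_blockOrderon_le {W : USq → USq → ℝ} (hW : IsOrderon W) {δ : ℝ} (hδ : 0 < δ)
    {s m n : ℕ} (hs : 1 ≤ s * δ ^ 2) (hm : 0 < m) (hn : 0 < n) :
    ∃ G : ℕ → ℕ → ℝ, (∀ i j, G i j ∈ Icc (0 : ℝ) 1) ∧ (∀ i j, G i j = G j i) ∧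
      csDist W (blockOrderon n G) ≤ 1 / m + 1 / n + (δ + 2 * (m * 4 ^ s / n)) := by
  obtain ⟨L, g, hL, hLk, hg, hgs, hcut⟩ := exists_step_approximation hW hδ hs
  obtain ⟨f, σ, B, hf, hshift, hB, hBn, hfm, hσ⟩ := exists_rearrangement hm hn hL hLk
  refine ⟨fun i j => g (σ i) (σ j), fun i j => hg _ _, fun i j => hgs _ _,
    csDist_le hf (by positivity) hshift fun S T hS hT => ?_⟩
  let M : USq → ℕ := fun u => σ (Qn n ((f u).1 : ℝ))
  have hM : Measurable M := (measurable_of_countable σ).comp hfm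
  have hi1 : Integrable fun p : USq × USq => W p.1 p.2 - g (L p.1) (L p.2) :=
    integrable_of_measurable_of_abs_le
      ((show Measurable fun p : USq × USq => W p.1 p.2 from hW.1).sub (measurable_step hL g))
      fun p => abs_sub_le_one_of_mem_Icc (hW.2.1 _ _) (hg _ _)
  have hi2 : Integrable fun p : USq × USq => g (L p.1) (L p.2) - g (M p.1) (M p.2) :=
    integrable_of_measurable_of_abs_le ((measurable_step hL g).sub (measurable_step hM g))
      fun p => abs_sub_le_one_of_mem_Icc (hg _ _) (hg _ _)
  have hsplit : ∀ p : USq × USq, W p.1 p.2 - g (M p.1) (M p.2) =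
      (W p.1 p.2 - g (L p.1) (L p.2)) + (g (L p.1) (L p.2) - g (M p.1) (M p.2)) :=
    fun p => by ring
  change |∫ p in S ×ˢ T, (W p.1 p.2 - g (M p.1) (M p.2))| ≤ _
  simp_rw [hsplit]
  rw [integral_add hi1.integrableOn hi2.integrableOn]
  refine (abs_add_le _ _).trans (add_le_add (hcut S T hS hT) ?_)
  refine (abs_setIntegral_step_sub_le hL hM hg hB hσ _).trans ?_
  push_cast at hBn
  linarith

/-- Naive block orderons are dense: there is `c > 0` such that every orderon `W` is
within cut-shift distance `ε` of the naive `n`-block orderon of some weighted ordered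
graph on `n ≤ (c/ε⁴)·2^{162/ε²}` vertices. -/
theorem block_orderon_dense :
    ∃ c : ℝ, 0 < c ∧ ∀ W : USq → USq → ℝ, IsOrderon W →
      ∀ ε : ℝ, ε ∈ Set.Ioo (0:ℝ) 1 →
        ∃ n : ℕ, 0 < n ∧ (n : ℝ) ≤ c / ε^4 * 2 ^ ((162:ℝ) / ε^2) ∧
          ∃ G : ℕ → ℕ → ℝ, (∀ i j, G i j ∈ Set.Icc (0:ℝ) 1) ∧
            (∀ i j, G i j = G j i) ∧ csDist W (blockOrderon n G) ≤ ε := by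
  refine ⟨180, by norm_num, fun W hW ε ⟨h0, h1⟩ => ?_⟩
  obtain ⟨s, hs, hs'⟩ : ∃ s : ℕ, 16 / ε ^ 2 ≤ s ∧ (s : ℝ) < 16 / ε ^ 2 + 1 :=
    ⟨⌈16 / ε ^ 2⌉₊, Nat.le_ceil _, Nat.ceil_lt_add_one (by positivity)⟩
  obtain ⟨m, hm, hm'⟩ : ∃ m : ℕ, 4 / ε ≤ m ∧ (m : ℝ) < 4 / ε + 1 :=
    ⟨⌈4 / ε⌉₊, Nat.le_ceil _, Nat.ceil_lt_add_one (by positivity)⟩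
  obtain ⟨q, hq, hq'⟩ : ∃ q : ℕ, 8 / ε ≤ q ∧ (q : ℝ) < 8 / ε + 1 :=
    ⟨⌈8 / ε⌉₊, Nat.le_ceil _, Nat.ceil_lt_add_one (by positivity)⟩
  have hm0 : (0 : ℝ) < m := (by positivity : (0 : ℝ) < 4 / ε).trans_le hm
  have hq0 : (0 : ℝ) < q := (by positivity : (0 : ℝ) < 8 / ε).trans_le hq
  have hmn : 0 < m := Nat.cast_pos.mp hm0
  have hqn : 0 < q := Nat.cast_pos.mp hq0
  have hinv : 1 ≤ 1 / ε := by rw [le_div_iff₀ h0]; linarith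
  have hn : 0 < m * 4 ^ s * q := by positivity
  obtain ⟨G, hG, hGs, hd⟩ := exists_csDist_blockOrderon_le hW (δ := ε / 4) (s := s) (by positivity)
    (by rw [div_le_iff₀ (by positivity)] at hs; linarith) hmn hn
  refine ⟨m * 4 ^ s * q, hn, ?_, G, hG, hGs, hd.trans ?_⟩
  · have h4 : (4 : ℝ) ^ s ≤ 4 * 2 ^ ((162 : ℝ) / ε ^ 2) := by
      have e1 : (4 : ℝ) ^ s = 2 ^ (2 * (s : ℝ)) := by
        rw [Real.rpow_mul (by norm_num), Real.rpow_natCast]; norm_num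
      have e2 : (4 : ℝ) * 2 ^ ((162 : ℝ) / ε ^ 2) = 2 ^ (2 + (162 : ℝ) / ε ^ 2) := by
        rw [Real.rpow_add (by norm_num)]; norm_num
      rw [e1, e2]
      refine Real.rpow_le_rpow_of_exponent_le (by norm_num) ?_
      have : 2 * (16 / ε ^ 2) ≤ 162 / ε ^ 2 := by
        rw [← mul_div_assoc]; gcongr; norm_num
      linarith
    have hm5 : (m : ℝ) ≤ 5 * (1 / ε) := by
      have : 4 / ε = 4 * (1 / ε) := by ring
      linarith
    have hq9 : (q : ℝ) ≤ 9 * (1 / ε) := by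
      have : 8 / ε = 8 * (1 / ε) := by ring
      linarith
    have h24 : (1 / ε) ^ 2 ≤ (1 / ε) ^ 4 := pow_le_pow_right₀ hinv (by norm_num)
    push_cast
    calc (m : ℝ) * 4 ^ s * q
        ≤ (5 * (1 / ε)) * (4 * 2 ^ ((162 : ℝ) / ε ^ 2)) * (9 * (1 / ε)) := by gcongr
      _ = 180 * (1 / ε) ^ 2 * 2 ^ ((162 : ℝ) / ε ^ 2) := by ring
      _ ≤ 180 * (1 / ε) ^ 4 * 2 ^ ((162 : ℝ) / ε ^ 2) := by gcongr
      _ = _ := by rw [one_div, inv_pow, ← div_eq_mul_inv]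
  · have h1m : 1 / (m : ℝ) ≤ ε / 4 := by
      rw [div_le_iff₀ h0] at hm
      rw [div_le_div_iff₀ hm0 (by norm_num)]; linarith
    have h1q : 1 / (q : ℝ) ≤ ε / 8 := by
      rw [div_le_iff₀ h0] at hq
      rw [div_le_div_iff₀ hq0 (by norm_num)]; linarith
    have hcast : ((m * 4 ^ s * q : ℕ) : ℝ) = m * 4 ^ s * q := by push_cast; rfl
    have h1n : 1 / ((m * 4 ^ s * q : ℕ) : ℝ) ≤ 1 / q := by
      refine one_div_le_one_div_of_le hq0 (Nat.cast_le.mpr ?_)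
      exact Nat.le_mul_of_pos_left _ (by positivity)
    have hbad : (m : ℝ) * 4 ^ s / ((m * 4 ^ s * q : ℕ) : ℝ) = 1 / q := by
      rw [hcast]; field_simp
    rw [hbad]
    linarith
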